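/- Let n ≥ 2 be an integer, p a prime, and r ≥ 2 an integer. Set q = p^r. Then S_n(q) = (q²/φ(q))·(V_n(q) − p^{n−2}·V_n(q/p)), where φ is Euler's totient function. -/

import Mathlib

open Finset

/-- The Kloosterman sum `K(u,v;q) = ∑_{x ∈ (ℤ/qℤ)^*} e^{2πi(ux + v x̄)/q}`. -/
noncomputable def Kl (q : ℕ) (u v : ℤ) : ℂ :=
  ∑ x ∈ Finset.range q,
    if Nat.Coprime x q then
      Complex.exp (2 * Real.pi * Complex.I *
        ((u : ℂ) * (x : ℂ) + (v : ℂ) * ((((x : ZMod q)⁻¹ : ZMod q).val : ℕ) : ℂ)) / (q : ℂ))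
    else 0

/-- The `n`-th power moment `S_n(q) = ∑_{u=1}^q K(u,1;q)^n`. -/
noncomputable def S (n q : ℕ) : ℂ :=
  ∑ u ∈ Finset.range q, Kl q ((u : ℤ) + 1) 1 ^ n

/-- `V_n(q)`: number of tuples `(x_1,…,x_{n-1})` of units mod `q` with
`(x_1+⋯+x_{n-1})·(x_1⁻¹+⋯+x_{n-1}⁻¹) ≡ 1 (mod q)`. -/
noncomputable def V (n q : ℕ) : ℕ :=
  Nat.card {x : Fin (n - 1) → (ZMod q)ˣ //
    (∑ i, ((x i : ZMod q))) * (∑ i, (((x i)⁻¹ : (ZMod q)ˣ) : ZMod q)) = 1}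

lemma ZMod.sum_range_natCast {M : Type*} [AddCommMonoid M] (q : ℕ) [NeZero q] (f : ZMod q → M) :
    ∑ x ∈ Finset.range q, f (x : ZMod q) = ∑ a, f a := by
  refine Finset.sum_nbij' (fun x => (x : ZMod q)) ZMod.val ?_ ?_ ?_ ?_ ?_
  · simp
  · intro a _
    simpa using ZMod.val_lt a
  · intro x hx
    exact ZMod.val_cast_of_lt (by simpa using hx)
  · intro a _
    exact ZMod.natCast_zmod_val a
  · simp

lemma Fintype.sum_units_eq_sum_ite_isUnit {R M : Type*} [Monoid R] [Fintype R] [DecidableEq R]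
    [AddCommMonoid M] [DecidablePred (IsUnit : R → Prop)] (f : R → M) :
    ∑ u : Rˣ, f u = ∑ a, if IsUnit a then f a else 0 := by
  rw [← Finset.sum_filter]
  refine Finset.sum_bij (fun u _ => (u : R)) ?_ ?_ ?_ ?_
  · simp
  · intro a _ b _ h
    exact Units.ext h
  · intro b hb
    obtain ⟨u, rfl⟩ := (Finset.mem_filter.mp hb).2
    exact ⟨u, Finset.mem_univ _, rfl⟩
  · simp

lemma Kl_eq_sum_units (q : ℕ) [NeZero q] (u v : ℤ) :
    Kl q u v = ∑ x : (ZMod q)ˣ,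
      ZMod.stdAddChar ((u : ZMod q) * (x : ZMod q) + (v : ZMod q) * ((x⁻¹ : (ZMod q)ˣ) : ZMod q)) := by
  classical
  have h : ∀ x : (ZMod q)ˣ, ((x⁻¹ : (ZMod q)ˣ) : ZMod q) = (x : ZMod q)⁻¹ := fun x => by
    rw [ZMod.inv_coe_unit]
  simp_rw [h]
  rw [Fintype.sum_units_eq_sum_ite_isUnit
    (fun a : ZMod q => (ZMod.stdAddChar ((u : ZMod q) * a + (v : ZMod q) * a⁻¹) : ℂ)),
    ← ZMod.sum_range_natCast, Kl]
  refine Finset.sum_congr rfl fun x _ => ?_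
  simp only [ZMod.isUnit_iff_coprime]
  refine if_congr Iff.rfl ?_ rfl
  have := ZMod.stdAddChar_coe (N := q) (u * x + v * ((((x : ZMod q)⁻¹ : ZMod q).val : ℕ) : ℤ))
  push_cast [ZMod.natCast_zmod_val] at this
  rw [this]

lemma AddChar.map_sum_eq_prod {ι A M : Type*} [AddCommMonoid A] [CommMonoid M] (ψ : AddChar A M)
    (s : Finset ι) (f : ι → A) : ψ (∑ i ∈ s, f i) = ∏ i ∈ s, ψ (f i) :=
  map_prod ψ.toMonoidHom (fun i => Multiplicative.ofAdd (f i)) s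

lemma S_eq_sum_stdAddChar (n q : ℕ) [NeZero q] :
    S n q = q * ∑ x : Fin n → (ZMod q)ˣ, if ∑ i, (x i : ZMod q) = 0 then
      ZMod.stdAddChar (∑ i, (((x i)⁻¹ : (ZMod q)ˣ) : ZMod q)) else 0 := by
  have h : S n q = ∑ u : ZMod q, (∑ x : (ZMod q)ˣ,
      ZMod.stdAddChar (u * (x : ZMod q) + ((x⁻¹ : (ZMod q)ˣ) : ZMod q))) ^ n := by
    rw [← Equiv.sum_comp (Equiv.addRight (1 : ZMod q)), ← ZMod.sum_range_natCast, S]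
    refine Finset.sum_congr rfl fun u _ => ?_
    simp [Kl_eq_sum_units]
  rw [h]
  simp_rw [Fintype.sum_pow, ← AddChar.map_sum_eq_prod, Finset.sum_add_distrib,
    AddChar.map_add_eq_mul]
  rw [Finset.sum_comm, Finset.mul_sum]
  refine Finset.sum_congr rfl fun x _ => ?_
  rw [← Finset.sum_mul]
  simp_rw [← Finset.mul_sum]
  rw [AddChar.sum_mulShift _ (ZMod.isPrimitive_stdAddChar q), ZMod.card]
  split_ifs <;> simp

lemma ZMod.stdAddChar_natCast_mul (p m : ℕ) [NeZero p] [NeZero m] (w : ZMod (p * m)) :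
    ZMod.stdAddChar ((p : ZMod (p * m)) * w) =
      ZMod.stdAddChar (ZMod.castHom (Dvd.intro_left p rfl) (ZMod m) w) := by
  obtain ⟨k, rfl⟩ := ZMod.intCast_surjective w
  have h := ZMod.stdAddChar_coe (N := p * m) (p * k)
  push_cast at h
  rw [h, map_intCast, ZMod.stdAddChar_coe]
  have : (p : ℂ) ≠ 0 := NeZero.ne _
  have : (m : ℂ) ≠ 0 := NeZero.ne _
  congr 1
  field_simp

lemma sum_units_stdAddChar (p m : ℕ) [NeZero m] (hp : p.Prime) [NeZero (p * m)]
    (h_unit : ∀ x : ℕ, x.Coprime (p * m) ↔ ¬ p ∣ x)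
    (w : ZMod (p * m)) :
    ∑ c : (ZMod (p * m))ˣ, ZMod.stdAddChar ((c : ZMod (p * m)) * w) =
      (if w = 0 then ((p * m : ℕ) : ℂ) else 0) -
        if ZMod.castHom (Dvd.intro_left p rfl) (ZMod m) w = 0 then (m : ℂ) else 0 := by
  classical
  have : NeZero p := ⟨hp.ne_zero⟩
  rw [Fintype.sum_units_eq_sum_ite_isUnit (fun a => (ZMod.stdAddChar (a * w) : ℂ)),
    eq_sub_iff_add_eq]
  have h₁ := AddChar.sum_mulShift w (ZMod.isPrimitive_stdAddChar (p * m))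
  have h₂ := AddChar.sum_mulShift (ZMod.castHom (Dvd.intro_left p rfl) (ZMod m) w)
    (ZMod.isPrimitive_stdAddChar m)
  rw [ZMod.card] at h₁ h₂
  push_cast only [Nat.cast_ite, Nat.cast_zero] at h₁ h₂
  rw [← h₁, ← h₂, ← ZMod.sum_range_natCast, ← ZMod.sum_range_natCast, ← ZMod.sum_range_natCast]
  have h₃ : ∑ d ∈ Finset.range m, ZMod.stdAddChar
      ((d : ZMod m) * ZMod.castHom (Dvd.intro_left p rfl) (ZMod m) w) =
      ∑ x ∈ Finset.range (p * m),
        if p ∣ x then (ZMod.stdAddChar ((x : ZMod (p * m)) * w) : ℂ) else 0 := by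
    rw [← Finset.sum_filter]
    refine Finset.sum_nbij' (fun d => p * d) (fun x => x / p) ?_ ?_ ?_ ?_ ?_
    · intro d hd
      simpa [hp.pos] using hd
    · intro x hx
      simp only [Finset.mem_filter, Finset.mem_range] at hx ⊢
      exact Nat.div_lt_of_lt_mul hx.1
    · intro d _
      exact Nat.mul_div_cancel_left d hp.pos
    · intro x hx
      exact Nat.mul_div_cancel' (Finset.mem_filter.mp hx).2
    · intro d _
      rw [Nat.cast_mul, mul_assoc, ZMod.stdAddChar_natCast_mul,
        map_mul (ZMod.castHom (Dvd.intro_left p rfl) (ZMod m)), map_natCast]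
  rw [h₃, ← Finset.sum_add_distrib]
  refine Finset.sum_congr rfl fun x _ => ?_
  simp only [ZMod.isUnit_iff_coprime, h_unit]
  split_ifs <;> simp

/-- Tuples of `m + 1` units summing to zero are determined by their last `m` entries. -/
lemma card_units_tuple_sum_eq_zero {R R' : Type*} [CommRing R] [CommRing R'] (f : R →+* R')
    [IsLocalHom f] (m : ℕ) :
    Nat.card {x : Fin (m + 1) → Rˣ //
      ∑ i, (x i : R) = 0 ∧ f (∑ i, (((x i)⁻¹ : Rˣ) : R)) = 0} =
    Nat.card {y : Fin m → Rˣ //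
      f ((∑ i, (y i : R)) * ∑ i, (((y i)⁻¹ : Rˣ) : R)) = 1} := by
  have key : ∀ (u : Rˣ) (s t : R), (u : R) + s = 0 →
      (f (((u⁻¹ : Rˣ) : R) + t) = 0 ↔ f (s * t) = 1) := by
    intro u s t h
    obtain rfl : s = -u := by linear_combination h
    have hu : f u * f ((u⁻¹ : Rˣ) : R) = 1 := by rw [← map_mul, Units.mul_inv, map_one]
    simp only [map_add, map_mul, map_neg]
    constructor <;> intro h
    · linear_combination (-f u) * h + hu
    · linear_combination (-f ((u⁻¹ : Rˣ) : R)) * h - f t * hu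
  refine Nat.card_congr (Equiv.ofBijective (fun x => ⟨Fin.tail x.1, ?_⟩) ⟨?_, ?_⟩)
  · obtain ⟨x, hx, hx'⟩ := x
    rw [Fin.sum_univ_succ] at hx hx'
    exact (key _ _ _ hx).1 hx'
  · rintro ⟨x, hx, hx'⟩ ⟨y, hy, hy'⟩ h
    have h' : Fin.tail x = Fin.tail y := congrArg Subtype.val h
    rw [Fin.sum_univ_succ] at hx hy
    have ht : ∀ i, x (Fin.succ i) = y (Fin.succ i) := fun i => congrFun h' i
    simp only [ht] at hx
    refine Subtype.ext (funext fun i => ?_)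
    refine Fin.cases (Units.ext ?_) ht i
    exact add_right_cancel (hx.trans hy.symm)
  · rintro ⟨y, hy⟩
    have hs : IsUnit (∑ i, (y i : R)) := by
      refine isUnit_of_map_unit f _ (IsUnit.of_mul_eq_one (f (∑ i, (((y i)⁻¹ : Rˣ) : R))) ?_)
      rw [← map_mul]
      exact hy
    have h₀ : ((-hs.unit : Rˣ) : R) + ∑ i, (y i : R) = 0 := by simp
    refine ⟨⟨Fin.cons (-hs.unit) y, ?_, ?_⟩, ?_⟩
    · simp [Fin.sum_univ_succ]
    · rw [Fin.sum_univ_succ]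
      simpa using (key _ _ _ h₀).2 hy
    · simp

lemma Nat.card_subtype_comp_of_surjective {G H : Type*} [Group G] [Group H] [Finite G] [Finite H]
    (f : G →* H) (hf : Function.Surjective f) (P : H → Prop) :
    Nat.card {g // P (f g)} = Nat.card f.ker * Nat.card {h // P h} := by
  have e : {g // P (f g)} ≃ f.ker × {h // P h} := by
    have s := Function.surjInv_eq hf
    refine
      { toFun := fun g => ⟨⟨g.1 * (Function.surjInv hf (f g.1))⁻¹, ?_⟩, ⟨f g.1, g.2⟩⟩
        invFun := fun a => ⟨a.1.1 * Function.surjInv hf a.2.1, ?_⟩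
        left_inv := ?_
        right_inv := ?_ }
    · simp [MonoidHom.mem_ker, s]
    · have : f a.1.1 = 1 := a.1.2
      simpa [s, this] using a.2.2
    · intro g
      simp
    · rintro ⟨⟨k, hk⟩, ⟨h, hh⟩⟩
      have hk' : f k = 1 := hk
      ext <;> simp [s, hk']
  rw [Nat.card_congr e, Nat.card_prod]

lemma totient_mul_S (n q : ℕ) [NeZero q] :
    (q.totient : ℂ) * S n q = q * ∑ x : Fin n → (ZMod q)ˣ, if ∑ i, (x i : ZMod q) = 0 then
      ∑ c : (ZMod q)ˣ, ZMod.stdAddChar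
        ((c : ZMod q) * ∑ i, (((x i)⁻¹ : (ZMod q)ˣ) : ZMod q)) else 0 := by
  have h : ∀ c : (ZMod q)ˣ, S n q = q * ∑ x : Fin n → (ZMod q)ˣ,
      if ∑ i, (x i : ZMod q) = 0 then ZMod.stdAddChar
        ((c : ZMod q) * ∑ i, (((x i)⁻¹ : (ZMod q)ˣ) : ZMod q)) else 0 := by
    intro c
    rw [S_eq_sum_stdAddChar, ← Equiv.sum_comp (Equiv.mulLeft (fun _ : Fin n => c⁻¹))]
    congr 1
    refine Finset.sum_congr rfl fun x _ => ?_
    simp [← Finset.mul_sum, mul_comm _ (c : ZMod q)]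
  rw [← ZMod.card_units_eq_totient, ← nsmul_eq_mul, ← Finset.card_univ, ← Finset.sum_const,
    Finset.sum_congr rfl fun c _ => h c, ← Finset.mul_sum, Finset.sum_comm]
  congr 1
  refine Finset.sum_congr rfl fun x _ => ?_
  split_ifs <;> simp

lemma card_units_tuple_castHom (p m l : ℕ) [NeZero m] (hp : p ≠ 0)
    (h_card : (p * m).totient = p * m.totient) :
    Nat.card {y : Fin l → (ZMod (p * m))ˣ //
      ZMod.castHom (Dvd.intro_left p rfl) (ZMod m)
        ((∑ i, (y i : ZMod (p * m))) * ∑ i, (((y i)⁻¹ : (ZMod (p * m))ˣ) : ZMod (p * m))) = 1} =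
    p ^ l * Nat.card {y : Fin l → (ZMod m)ˣ //
      (∑ i, (y i : ZMod m)) * ∑ i, (((y i)⁻¹ : (ZMod m)ˣ) : ZMod m) = 1} := by
  have : NeZero (p * m) := ⟨mul_ne_zero hp (NeZero.ne m)⟩
  have hd : m ∣ p * m := Dvd.intro_left p rfl
  let F : (Fin l → (ZMod (p * m))ˣ) →* (Fin l → (ZMod m)ˣ) := (ZMod.unitsMap hd).compLeft (Fin l)
  have hF : Function.Surjective F := (ZMod.unitsMap_surjective hd).comp_left
  have hker : Nat.card F.ker = p ^ l := by
    have h := Nat.card_subtype_comp_of_surjective F hF (fun _ => True)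
    rw [Nat.card_congr (Equiv.subtypeUnivEquiv fun _ => trivial),
      Nat.card_congr (Equiv.subtypeUnivEquiv fun _ => trivial)] at h
    rw [Nat.card_fun, Nat.card_fun, Nat.card_eq_fintype_card (α := (ZMod (p * m))ˣ),
      Nat.card_eq_fintype_card (α := (ZMod m)ˣ), Nat.card_fin, ZMod.card_units_eq_totient,
      ZMod.card_units_eq_totient, h_card, mul_pow] at h
    exact (Nat.eq_of_mul_eq_mul_right
      (pow_pos (Nat.totient_pos.2 (NeZero.pos m)) l) h).symm
  rw [← hker, ← Nat.card_subtype_comp_of_surjective F hF]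
  refine Nat.card_congr (Equiv.subtypeEquivRight fun y => ?_)
  rw [map_mul, map_sum, map_sum]
  rfl

lemma totient_mul_S_eq (p m l : ℕ) [NeZero m] (hp : p.Prime)
    (h_unit : ∀ x : ℕ, x.Coprime (p * m) ↔ ¬ p ∣ x)
    (h_local : IsLocalHom (ZMod.castHom (Dvd.intro_left p rfl : m ∣ p * m) (ZMod m)))
    (h_card : (p * m).totient = p * m.totient) :
    ((p * m).totient : ℂ) * S (l + 1) (p * m) =
      (p * m : ℂ) * (p * m * V (l + 1) (p * m) - m * (p ^ l * V (l + 1) m)) := by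
  classical
  have : NeZero (p * m) := ⟨mul_ne_zero hp.ne_zero (NeZero.ne m)⟩
  have hid : IsLocalHom (RingHom.id (ZMod (p * m))) := ⟨fun _ h => h⟩
  have h₁ : V (l + 1) (p * m) = Nat.card {x : Fin (l + 1) → (ZMod (p * m))ˣ //
      ∑ i, (x i : ZMod (p * m)) = 0 ∧
        ∑ i, (((x i)⁻¹ : (ZMod (p * m))ˣ) : ZMod (p * m)) = 0} :=
    (card_units_tuple_sum_eq_zero (RingHom.id (ZMod (p * m))) l).symm
  have h₂ : p ^ l * V (l + 1) m = Nat.card {x : Fin (l + 1) → (ZMod (p * m))ˣ //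
      ∑ i, (x i : ZMod (p * m)) = 0 ∧ ZMod.castHom (Dvd.intro_left p rfl) (ZMod m)
        (∑ i, (((x i)⁻¹ : (ZMod (p * m))ˣ) : ZMod (p * m))) = 0} := by
    rw [card_units_tuple_sum_eq_zero]
    exact (card_units_tuple_castHom p m l hp.ne_zero h_card).symm
  rw [totient_mul_S]
  simp_rw [sum_units_stdAddChar p m hp h_unit]
  have h₂' : (p : ℂ) ^ l * V (l + 1) m = ((p ^ l * V (l + 1) m : ℕ) : ℂ) := by push_cast; rfl
  rw [h₂', h₁, h₂, Nat.card_eq_fintype_card, Nat.card_eq_fintype_card, Fintype.card_subtype,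
    Fintype.card_subtype, Finset.natCast_card_filter, Finset.natCast_card_filter,
    Finset.mul_sum (a := (p * m : ℂ)), Finset.mul_sum (a := (m : ℂ)), ← Finset.sum_sub_distrib]
  push_cast
  congr 1
  refine Finset.sum_congr rfl fun x _ => ?_
  simp only [ite_and]
  split_ifs <;> simp

lemma ZMod.isLocalHom_castHom_of_coprime_iff {p m : ℕ} [NeZero m] (hm : p ∣ m) (hp : p.Prime)
    (h_unit : ∀ x : ℕ, x.Coprime (p * m) ↔ ¬ p ∣ x) :
    IsLocalHom (ZMod.castHom (Dvd.intro_left p rfl : m ∣ p * m) (ZMod m)) := by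
  have : NeZero (p * m) := ⟨mul_ne_zero hp.ne_zero (NeZero.ne m)⟩
  refine ⟨fun a ha => ?_⟩
  obtain ⟨x, rfl⟩ := ZMod.natCast_zmod_surjective a
  rw [map_natCast, ZMod.isUnit_iff_coprime] at ha
  rw [ZMod.isUnit_iff_coprime, h_unit, ← hp.coprime_iff_not_dvd]
  exact (ha.coprime_dvd_right hm).symm

/-- For `n ≥ 2`, `p` prime and `r ≥ 2`, with `q = p^r`:
`S_n(q) = (q²/φ(q))·(V_n(q) − p^(n−2)·V_n(q/p))`. -/
theorem power_moment_eq_V (n p r : ℕ) (hn : 2 ≤ n) (hp : p.Prime) (hr : 2 ≤ r) :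
    S n (p ^ r) =
      ((p : ℂ) ^ (2 * r) / (Nat.totient (p ^ r) : ℂ)) *
        ((V n (p ^ r) : ℂ) - (p : ℂ) ^ (n - 2) * (V n (p ^ (r - 1)) : ℂ)) := by
  obtain ⟨l, rfl⟩ := Nat.exists_eq_add_of_le' hn
  obtain ⟨k, rfl⟩ := Nat.exists_eq_add_of_le' hr
  have hm : p ∣ p ^ (k + 1) := dvd_pow_self p k.succ_ne_zero
  have : NeZero (p ^ (k + 1)) := ⟨pow_ne_zero _ hp.ne_zero⟩
  have h_unit : ∀ x : ℕ, x.Coprime (p * p ^ (k + 1)) ↔ ¬ p ∣ x := fun x => by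
    rw [← pow_succ', Nat.coprime_pow_right_iff (by omega), Nat.coprime_comm,
      hp.coprime_iff_not_dvd]
  have h_card : (p * p ^ (k + 1)).totient = p * (p ^ (k + 1)).totient :=
    Nat.totient_mul_of_prime_of_dvd hp hm
  have key := totient_mul_S_eq p (p ^ (k + 1)) (l + 1) hp h_unit
    (ZMod.isLocalHom_castHom_of_coprime_iff hm hp h_unit) h_card
  have hφ : ((p ^ (k + 2)).totient : ℂ) ≠ 0 := by
    exact_mod_cast (Nat.totient_pos.2 (pow_pos hp.pos _)).ne'
  rw [← pow_succ'] at key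
  rw [div_mul_eq_mul_div, eq_div_iff hφ, mul_comm, key]
  push_cast
  ring
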